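/- arXiv:1602.07171 — 4 statements merged into one kernel-verified Lean document; each statement's English description precedes it below -/
import Mathlib

section
/- If a hypohamiltonian graph G has a 3-edge-cut C, then one of the two components of G - C consists of a single vertex. -/
open SimpleGraph

/-- A graph is hamiltonian if it has a cycle passing through all vertices. -/
def IsHamiltonianGraph {β : Type*} [DecidableEq β] (H : SimpleGraph β) : Prop :=
  ∃ (a : β) (p : H.Walk a a), p.IsHamiltonianCycle

/-- A finite graph is hypohamiltonian if it is not hamiltonian but every
vertex-deleted subgraph is hamiltonian. -/
def Hypohamiltonian {α : Type*} [Fintype α] [DecidableEq α] (G : SimpleGraph α) : Prop :=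
  Nonempty α ∧ ¬ IsHamiltonianGraph G ∧
    ∀ v : α, IsHamiltonianGraph (G.induce ({v}ᶜ : Set α))

/-- Cyclic list of adjacent vertices. -/
def CycL {α : Type*} (G : SimpleGraph α) (l : List α) : Prop :=
  l.IsChain G.Adj ∧ ∀ x ∈ l.getLast?, ∀ y ∈ l.head?, G.Adj x y

theorem CycL.rot {α : Type*} {G : SimpleGraph α} {s r : List α} (h : CycL G (s ++ r)) :
    CycL G (r ++ s) := by
  rcases s.eq_nil_or_concat with rfl | ⟨s', a, rfl⟩
  · simpa using h
  rcases r.eq_nil_or_concat with rfl | ⟨r', b, rfl⟩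
  · simpa using h
  unfold CycL at *
  simp only [List.isChain_append] at *
  simp only [List.concat_eq_append] at *
  refine ⟨⟨h.1.2.1, h.1.1, ?_⟩, ?_⟩
  · have := h.2
    cases s' <;> simpa [List.getLast?_append, List.getLast?_cons] using this
  · have := h.1.2.2
    cases r' <;> simpa [List.getLast?_append, List.getLast?_cons] using this

theorem split_list {α : Type*} (P : α → Prop) (l : List α) :
    ∃ s r, l = s ++ r ∧ (∀ x ∈ s, P x) ∧ (∀ x ∈ r.head?, ¬ P x) := by
  induction l with
  | nil => exact ⟨[], [], by simp⟩
  | cons a t ih =>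
    by_cases h : P a
    · obtain ⟨s, r, rfl, h1, h2⟩ := ih
      exact ⟨a :: s, r, by simp, by simpa using ⟨h, h1⟩, h2⟩
    · exact ⟨[], a :: t, by simp, by simp, by simpa using h⟩

theorem cyc_of_ham {α : Type*} [DecidableEq α] {G : SimpleGraph α} {v : α}
    (h : IsHamiltonianGraph (G.induce ({v}ᶜ : Set α))) :
    ∃ l : List α, l.Nodup ∧ (∀ x, x ∈ l ↔ x ≠ v) ∧ 3 ≤ l.length ∧ CycL G l := by
  obtain ⟨a, p, hp⟩ := h
  have h3 := hp.isCycle.three_le_length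
  have ht := hp.isHamiltonian_tail
  cases p with
  | nil => simp at h3
  | cons hab q =>
    have hq : q.IsHamiltonian := by
      intro x
      have := ht x
      simpa using this
    refine ⟨q.support.map Subtype.val, ?_, ?_, ?_, ?_, ?_⟩
    · exact hq.isPath.support_nodup.map Subtype.val_injective
    · intro x
      simp only [List.mem_map]
      constructor
      · rintro ⟨y, -, rfl⟩
        exact y.2
      · intro hx
        exact ⟨⟨x, hx⟩, hq.mem_support _, rfl⟩
    · simpa using h3
    · rw [List.isChain_map]
      exact q.isChain_adj_support.imp (fun _ _ h => h)
    · intro x hx y hy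
      rw [List.getLast?_map, List.getLast?_eq_some_getLast q.support_ne_nil,
        q.getLast_support] at hx
      rw [List.head?_map, List.head?_eq_some_head q.support_ne_nil, q.head_support] at hy
      simp at hx hy
      subst hx hy
      exact hab

theorem ham_of_cyc {α : Type*} [Fintype α] [DecidableEq α] {G : SimpleGraph α} {l : List α}
    (hn : l.Nodup) (hm : ∀ x, x ∈ l) (h3 : 3 ≤ l.length) (hc : CycL G l) :
    IsHamiltonianGraph G := by
  have hne : l ≠ [] := by rintro rfl; simp at h3
  let q := Walk.ofSupport l hne hc.1
  have hs : q.support = l := Walk.support_ofSupport hne hc.1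
  have hadj : G.Adj (l.getLast hne) (l.head hne) :=
    hc.2 _ (List.getLast?_eq_some_getLast hne) _ (List.head?_eq_some_head hne)
  have hqp : q.IsPath := by rw [Walk.isPath_def, hs]; exact hn
  have hl : 2 ≤ q.length := by
    have := q.length_support
    rw [hs] at this
    omega
  refine ⟨_, Walk.cons hadj q, ?_, ?_⟩
  · rw [Walk.cons_isCycle_iff]
    refine ⟨hqp, ?_⟩
    clear_value q
    generalize l.getLast hne = w at *
    generalize l.head hne = u at *
    intro hmem
    cases q with
    | nil => simp at hl
    | @cons _ k _ h q =>
      rw [Walk.cons_isPath_iff] at hqp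
      rw [Walk.edges_cons, List.mem_cons] at hmem
      rcases hmem with hmem | hmem
      · simp only [Sym2.eq_iff] at hmem
        have : w = k := by
          rcases hmem with ⟨h1, h2⟩ | ⟨h1, h2⟩
          · exact absurd h1 hadj.ne
          · exact h1
        subst this
        have := (Walk.isPath_iff_nil.1 hqp.1).eq_nil
        subst this
        simp at hl
      · exact hqp.2 (q.snd_mem_support_of_mem_edges hmem)
  · intro x
    have : q.support.count x = 1 := by
      rw [hs]
      exact List.count_eq_one_of_mem hn (hm x)
    simpa using this

theorem side_path {α : Type*} [Fintype α] [DecidableEq α] {G : SimpleGraph α} {v : α}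
    (h : IsHamiltonianGraph (G.induce ({v}ᶜ : Set α))) (A B : Set α)
    (hAB : ∀ x, x ∈ A ↔ x ∉ B) (hv : v ∈ A) (hA : ∃ a ∈ A, a ≠ v) (hB : ∃ b, b ∈ B)
    (hX : ∀ x y z : α × α, (∀ w ∈ [x, y, z], w.1 ∈ A ∧ w.2 ∈ B ∧ w.1 ≠ v ∧ G.Adj w.1 w.2) →
      x ≠ y → x ≠ z → y ≠ z → False) :
    ∃ y z : α × α, y ≠ z ∧ (∀ w ∈ [y, z], w.1 ∈ A ∧ w.2 ∈ B ∧ w.1 ≠ v ∧ G.Adj w.1 w.2) ∧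
      ∃ l : List α, l.Nodup ∧ (∀ x, x ∈ l ↔ x ∈ B) ∧ l.IsChain G.Adj ∧ l.head? = some y.2 ∧
        l.getLast? = some z.2 := by
  obtain ⟨l, hn, hm, h3, hc⟩ := cyc_of_ham h
  obtain ⟨a, haA, hav⟩ := hA
  obtain ⟨b, hb⟩ := hB
  obtain ⟨s, t, rfl⟩ := List.append_of_mem ((hm a).2 hav)
  replace hc := hc.rot
  obtain ⟨L, hL⟩ : ∃ L, L = t ++ s := ⟨_, rfl⟩
  have hcL : CycL G (a :: L) := by rw [hL]; simpa using hc
  have hnL : (a :: L).Nodup := by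
    rw [hL]
    exact (List.perm_append_comm (l₁ := s) (l₂ := a :: t)).nodup hn
  have hmL : ∀ x, x ∈ a :: L ↔ x ≠ v := by
    intro x
    rw [← hm x, hL]
    simp
    tauto
  have h3L : 3 ≤ (a :: L).length := by rw [hL]; simp at h3 ⊢; omega
  clear hc hm hn h3 hL s t
  obtain ⟨s, r, rfl, hs, hr⟩ := split_list (· ∈ A) L
  obtain ⟨l1, q, rfl, hl1, hq⟩ := split_list (· ∈ B) r
  obtain ⟨m1, m2, rfl, hm1, hm2⟩ := split_list (· ∈ A) q
  have hbm := (hmL b).2 (by rintro rfl; exact (hAB _).1 hv hb)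
  have hl1ne : l1 ≠ [] := by
    rintro rfl
    have hq' : m1 ++ m2 = [] := by
      rcases hh : m1 ++ m2 with _ | ⟨c, u⟩
      · rfl
      · simp [hh] at hr hq
        exact absurd ((hAB c).2 hq) hr
    simp [hq'] at hbm
    rcases hbm with rfl | hbm
    · exact (hAB _).1 haA hb
    · exact (hAB _).1 (hs _ hbm) hb
  obtain ⟨s', c, hs'⟩ : ∃ s' c, a :: s = s' ++ [c] := by
    rcases (a :: s).eq_nil_or_concat with h | ⟨s', c, h⟩
    · simp at h
    · exact ⟨s', c, by simpa using h⟩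
  have hsA : ∀ x ∈ a :: s, x ∈ A := by
    intro x hx
    rcases List.mem_cons.1 hx with rfl | hx
    · exact haA
    · exact hs _ hx
  obtain ⟨hch, hcl⟩ := hcL
  rw [← List.cons_append] at hch hcl hnL hmL h3L
  obtain ⟨d, l1', hd⟩ := List.exists_cons_of_ne_nil hl1ne
  obtain ⟨l1'', e, he⟩ : ∃ s' c, l1 = s' ++ [c] := by
    rcases l1.eq_nil_or_concat with h | ⟨s', c, h⟩
    · exact absurd h hl1ne
    · exact ⟨s', c, by simpa using h⟩
  have hdB : d ∈ B := hl1 _ (by simp [hd])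
  have heB : e ∈ B := hl1 _ (by simp [he])
  have hcA : c ∈ A := hsA _ (by simp [hs'])
  rw [List.isChain_append] at hch
  obtain ⟨hch1, hch2, hch3⟩ := hch
  rw [List.isChain_append] at hch2
  obtain ⟨hch4, hch5, hch6⟩ := hch2
  have hcd : G.Adj c d := hch3 c (by simp [hs']) d (by simp [hd])
  have hnv : ∀ x, (x ∈ a :: s ∨ x ∈ l1 ∨ x ∈ m1 ∨ x ∈ m2) → x ≠ v := by
    intro x hx
    rw [← hmL]
    simpa [or_assoc] using hx
  have hcv : c ≠ v := hnv c (by simp [hs'])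
  have hnn := hnL
  rw [List.nodup_append] at hnn
  obtain ⟨hn1, hn2, hn3⟩ := hnn
  rw [List.nodup_append] at hn2
  obtain ⟨hn4, hn5, hn6⟩ := hn2
  rcases m2 with _ | ⟨g, m2'⟩
  · obtain ⟨f, hfA, hfv, hfe, hne⟩ : ∃ f ∈ A, f ≠ v ∧ G.Adj f e ∧ (c, d) ≠ (f, e) := by
      rcases m1 with _ | ⟨f, m1'⟩
      · refine ⟨a, haA, hav, ?_, ?_⟩
        · exact (hcl e (by simp [he, List.getLast?_append, List.getLast?_cons]) a (by simp)).symm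
        · intro hh
          simp only [Prod.mk.injEq] at hh
          obtain ⟨rfl, rfl⟩ := hh
          have h1 : s' = [] := by
            rcases s' with _ | ⟨k, s''⟩
            · rfl
            · simp at hs'
              rw [hs'.1, hs'.2] at hn1
              simp [← hs'.1] at hn1
          have h2 : l1' = [] := by
            rcases l1'' with _ | ⟨k, s''⟩
            · rw [hd] at he; simpa using he
            · rw [hd] at he
              simp at he
              rw [hd, he.1, he.2] at hn4
              simp [← he.1] at hn4
          rw [hs', h1, hd, h2] at h3L
          simp at h3L
      · refine ⟨f, hm1 f (by simp), hnv f (by simp), (hch6 e (by simp [he]) f (by simp)).symm, ?_⟩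
        intro hh
        simp only [Prod.mk.injEq] at hh
        exact hn3 c (by simp [hs']) f (by simp) hh.1
    refine ⟨(c, d), (f, e), hne, ?_, l1, hn4, ?_, hch4, by simp [hd], by simp [he]⟩
    · simp [hcA, hdB, hcv, hcd, hfA, heB, hfv, hfe]
    · intro x
      refine ⟨hl1 x, fun hx => ?_⟩
      have h1 := (hmL x).2 (by rintro rfl; exact (hAB _).1 hv hx)
      rw [List.mem_append, List.mem_append] at h1
      rcases h1 with h1 | h1 | h1
      · exact absurd hx ((hAB _).1 (hsA _ h1))
      · exact h1
      · exact absurd hx ((hAB _).1 (hm1 _ (by simpa using h1)))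
  · exfalso
    have hgA : g ∉ A := by simpa using hm2
    have hgB : g ∈ B := by
      by_contra hg
      exact hgA ((hAB g).2 hg)
    rcases m1 with _ | ⟨f, m1'⟩
    · simp at hq
      exact hq hgB
    obtain ⟨m1'', k, hk⟩ : ∃ s' c, f :: m1' = s' ++ [c] := by
      rcases (f :: m1').eq_nil_or_concat with h | ⟨s', c, h⟩
      · simp at h
      · exact ⟨s', c, by simpa using h⟩
    have hkm : k ∈ f :: m1' := by rw [hk]; simp
    have hfA : f ∈ A := hm1 f (by simp)
    have hkA : k ∈ A := hm1 k hkm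
    have hfe : G.Adj f e := (hch6 e (by simp [he]) f (by simp)).symm
    rw [List.isChain_append] at hch5
    have hkg : G.Adj k g := hch5.2.2 k (by simp [hk]) g (by simp)
    have hfv : f ≠ v := hnv f (by simp)
    have hkv : k ≠ v := hnv k (.inr (.inr (.inl hkm)))
    have hcm : c ∈ a :: s := by simp [hs']
    refine hX (c, d) (f, e) (k, g) (by simp [hcA, hdB, hcv, hcd, hfA, heB, hfv, hfe, hkA, hgB, hkv, hkg]) ?_ ?_ ?_ <;> intro hh <;>
      simp only [Prod.mk.injEq] at hh
    · exact hn3 c hcm f (by simp) hh.1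
    · exact hn3 c hcm k (List.mem_append_right _ (List.mem_append_left _ hkm)) hh.1
    · exact hn6 e (by simp [he]) g (by simp) hh.2

theorem glue {α : Type*} [Fintype α] [DecidableEq α] {G : SimpleGraph α} {A B : Set α}
    (hAB : ∀ x, x ∈ A ↔ x ∉ B) {LA LB : List α} (hnA : LA.Nodup) (hnB : LB.Nodup)
    (hmA : ∀ x, x ∈ LA ↔ x ∈ A) (hmB : ∀ x, x ∈ LB ↔ x ∈ B)
    (hcA : LA.IsChain G.Adj) (hcB : LB.IsChain G.Adj) {a a' b b' : α}
    (h1 : LA.head? = some a) (h2 : LA.getLast? = some a')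
    (h3 : LB.head? = some b) (h4 : LB.getLast? = some b')
    (hab : G.Adj a b) (hab' : G.Adj a' b') (hA2 : ∃ x ∈ A, ∃ y ∈ A, x ≠ y) :
    IsHamiltonianGraph G := by
  have hneA : LA ≠ [] := by rintro rfl; simp at h1
  have hneB : LB ≠ [] := by rintro rfl; simp at h3
  refine ham_of_cyc (l := LA ++ LB.reverse) ?_ ?_ ?_ ⟨?_, ?_⟩
  · rw [List.nodup_append]
    refine ⟨hnA, List.nodup_reverse.2 hnB, ?_⟩
    rintro x hx y hy rfl
    exact (hAB x).1 ((hmA x).1 hx) ((hmB x).1 (List.mem_reverse.1 hy))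
  · intro x
    rw [List.mem_append, List.mem_reverse, hmA, hmB, hAB]
    tauto
  · obtain ⟨x, hx, y, hy, hxy⟩ := hA2
    rw [← hmA] at hx hy
    rcases LA with _ | ⟨p, _ | ⟨q, r⟩⟩
    · simp at hx
    · simp at hx hy
      exact absurd (hx.trans hy.symm) hxy
    · have := List.length_pos_of_ne_nil hneB
      simp
      omega
  · rw [List.isChain_append]
    refine ⟨hcA, ?_, ?_⟩
    · rw [List.isChain_reverse]
      exact hcB.imp fun _ _ h => h.symm
    · rw [List.head?_reverse, h2, h4]
      simpa using hab'
  · rw [List.getLast?_append, List.getLast?_reverse, List.head?_append, h1, h3]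
    simpa using hab.symm

theorem hypohamiltonian_three_edge_cut {α : Type*} [Fintype α] [DecidableEq α]
    (G : SimpleGraph α) (hG : Hypohamiltonian G)
    (C : Set (Sym2 α)) (hCsub : C ⊆ G.edgeSet) (hCcard : C.ncard = 3)
    (A B : Set α) (hunion : A ∪ B = Set.univ) (hdisj : Disjoint A B)
    (hA : ((G.deleteEdges C).induce A).Connected)
    (hB : ((G.deleteEdges C).induce B).Connected)
    (hsep : ∀ a ∈ A, ∀ b ∈ B, ¬ (G.deleteEdges C).Adj a b) :
    A.ncard = 1 ∨ B.ncard = 1 := by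
  obtain ⟨-, hnot, hham⟩ := hG
  by_contra hcon
  push Not at hcon
  have hAB : ∀ x, x ∈ A ↔ x ∉ B := by
    intro x
    have h1 : x ∈ A ∪ B := by rw [hunion]; trivial
    exact ⟨fun h h' => Set.disjoint_left.1 hdisj h h', fun h => h1.resolve_right h⟩
  have hBA : ∀ x, x ∈ B ↔ x ∉ A := fun x => by rw [hAB]; tauto
  have two : ∀ S : Set α, ((G.deleteEdges C).induce S).Connected → S.ncard ≠ 1 →
      ∀ v, ∃ a ∈ S, a ≠ v := by
    intro S hS h1 v
    by_contra hh
    push Not at hh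
    obtain ⟨w⟩ := hS.nonempty
    apply h1
    rw [Set.ncard_eq_one]
    refine ⟨v, Set.eq_singleton_iff_unique_mem.2 ⟨?_, hh⟩⟩
    rw [← hh w w.2]; exact w.2
  have hA2 := two A hA hcon.1
  have hB2 := two B hB hcon.2
  obtain ⟨a0⟩ := hA.nonempty
  obtain ⟨b0⟩ := hB.nonempty
  let X : Set (α × α) := {w | w.1 ∈ A ∧ w.2 ∈ B ∧ G.Adj w.1 w.2}
  have hXcard : X.ncard ≤ 3 := by
    rw [← hCcard]
    refine Set.ncard_le_ncard_of_injOn (fun w => s(w.1, w.2)) ?_ ?_ (Set.toFinite _)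
    · rintro ⟨a, b⟩ ⟨h1, h2, h3⟩
      by_contra h4
      exact hsep a h1 b h2 (by rw [deleteEdges_adj]; exact ⟨h3, h4⟩)
    · rintro ⟨a, b⟩ ⟨h1, h2, h3⟩ ⟨a', b'⟩ ⟨h1', h2', h3'⟩ h
      simp only [Sym2.eq_iff] at h
      rcases h with ⟨h, h'⟩ | ⟨h, h'⟩
      · simp [h, h']
      · simp only at h1 h2'
        rw [h] at h1
        exact absurd h2' ((hAB _).1 h1)
  have four : ∀ x ∈ X, ∀ y ∈ X, ∀ z ∈ X, ∀ w ∈ X, x ≠ y → x ≠ z → x ≠ w → y ≠ z → y ≠ w →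
      z ≠ w → False := by
    intro x hx y hy z hz w hw h1 h2 h3 h4 h5 h6
    have hsub : (({x, y, z, w} : Finset (α × α)) : Set (α × α)) ⊆ X := by
      intro u hu
      simp at hu
      rcases hu with rfl | rfl | rfl | rfl <;> assumption
    have := Set.ncard_le_ncard hsub (Set.toFinite _)
    rw [Set.ncard_coe_finset] at this
    have hc : ({x, y, z, w} : Finset (α × α)).card = 4 := by
      rw [Finset.card_insert_of_notMem, Finset.card_insert_of_notMem, Finset.card_pair h6] <;>
        simp [*]
    omega
  have hXne : ∃ x, x ∈ X := by
    by_contra hne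
    push Not at hne
    obtain ⟨y, z, -, h, -⟩ := side_path (hham a0) A B hAB a0.2 (hA2 a0) ⟨b0, b0.2⟩ (by
      intro x y z h _ _ _
      have := h x (by simp)
      exact hne x ⟨this.1, this.2.1, this.2.2.2⟩)
    have := h y (by simp)
    exact hne y ⟨this.1, this.2.1, this.2.2.2⟩
  obtain ⟨x, hx⟩ := hXne
  obtain ⟨y, z, hyz, hw, LB, hnB, hmB, hcB, hhB, hlB⟩ :=
    side_path (hham x.1) A B hAB hx.1 (hA2 _) ⟨b0, b0.2⟩ (by
      intro p q r h h1 h2 h3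
      have hp := h p (by simp)
      have hq := h q (by simp)
      have hr := h r (by simp)
      refine four x hx p ⟨hp.1, hp.2.1, hp.2.2.2⟩ q ⟨hq.1, hq.2.1, hq.2.2.2⟩ r
        ⟨hr.1, hr.2.1, hr.2.2.2⟩ ?_ ?_ ?_ h1 h2 h3 <;> rintro rfl
      · exact hp.2.2.1 rfl
      · exact hq.2.2.1 rfl
      · exact hr.2.2.1 rfl)
  obtain ⟨y', z', hyz', hw', LA, hnA, hmA, hcA, hhA, hlA⟩ :=
    side_path (hham x.2) B A hBA hx.2.1 (hB2 _) ⟨a0, a0.2⟩ (by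
      intro p q r h h1 h2 h3
      have hp := h p (by simp)
      have hq := h q (by simp)
      have hr := h r (by simp)
      refine four x hx p.swap ⟨hp.2.1, hp.1, hp.2.2.2.symm⟩ q.swap ⟨hq.2.1, hq.1, hq.2.2.2.symm⟩
        r.swap ⟨hr.2.1, hr.1, hr.2.2.2.symm⟩ ?_ ?_ ?_ (by simpa using h1) (by simpa using h2)
        (by simpa using h3) <;> rintro rfl
      · exact hp.2.2.1 rfl
      · exact hq.2.2.1 rfl
      · exact hr.2.2.1 rfl)
  have hy := hw y (by simp)
  have hz := hw z (by simp)
  have hy' := hw' y' (by simp)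
  have hz' := hw' z' (by simp)
  have key : ∀ p : α × α, p.1 ∈ B ∧ p.2 ∈ A ∧ p.1 ≠ x.2 ∧ G.Adj p.1 p.2 →
      p.swap = y ∨ p.swap = z := by
    intro p hp
    by_contra hh
    push Not at hh
    refine four x hx y ⟨hy.1, hy.2.1, hy.2.2.2⟩ z ⟨hz.1, hz.2.1, hz.2.2.2⟩ p.swap
      ⟨hp.2.1, hp.1, hp.2.2.2.symm⟩ ?_ ?_ ?_ hyz hh.1.symm hh.2.symm
    · rintro rfl; exact hy.2.2.1 rfl
    · rintro rfl; exact hz.2.2.1 rfl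
    · rintro rfl; exact hp.2.2.1 rfl
  have hA2' : ∃ x ∈ A, ∃ y ∈ A, x ≠ y := by
    obtain ⟨a, ha, hne⟩ := hA2 a0
    exact ⟨a, ha, a0, a0.2, hne⟩
  apply hnot
  rcases key y' hy' with h1 | h1 <;> rcases key z' hz' with h2 | h2
  · exact absurd (Prod.swap_injective (h1.trans h2.symm)) hyz'
  · subst h1 h2
    exact glue hAB hnA hnB hmA hmB hcA hcB hhA hlA hhB hlB hy.2.2.2 hz.2.2.2 hA2'
  · subst h1 h2
    refine glue hAB hnA (List.nodup_reverse.2 hnB) hmA (fun x => by rw [List.mem_reverse, hmB])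
      hcA (List.isChain_reverse.2 (hcB.imp fun _ _ h => h.symm)) hhA hlA
      (by rw [List.head?_reverse, hlB]) (by rw [List.getLast?_reverse, hhB])
      hz.2.2.2 hy.2.2.2 hA2'
  · exact absurd (Prod.swap_injective (h1.trans h2.symm)) hyz'
end

section
/- Let G be a hypohamiltonian graph containing a 3-vertex-cut M = {u, v, w}. Then no two vertices of M are adjacent in G. -/
open SimpleGraph

theorem ham_list {α : Type*} [DecidableEq α] (G : SimpleGraph α) (x y : α) (hxy : y ≠ x)
    (h : IsHamiltonianGraph (G.induce ({x}ᶜ : Set α))) :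
    ∃ L : List α, List.IsChain G.Adj (y :: (L ++ [y])) ∧ (y :: L).Nodup ∧ 2 ≤ L.length ∧
      ∀ t, t ∈ y :: L ↔ t ≠ x := by
  obtain ⟨a, p0, hp0⟩ := h
  have hy : (⟨y, by simpa using hxy⟩ : ({x}ᶜ : Set α)) ∈ p0.support := hp0.mem_support _
  have hp := (Walk.isHamiltonianCycle_rotate hy).2 hp0
  generalize p0.rotate _ hy = p at hp
  have hlen := hp.three_le_length
  have hch := p.isChain_adj_support
  have hnd : p.support.tail.Nodup := by
    rw [← Walk.support_tail_of_not_nil _ hp.isCycle.not_nil]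
    exact hp.isHamiltonian_tail.isPath.support_nodup
  have hall : ∀ t, t ∈ p.support.tail := by
    rw [← Walk.support_tail_of_not_nil _ hp.isCycle.not_nil]
    exact hp.isHamiltonian_tail.mem_support
  cases p with
  | nil => simp at hlen
  | cons hadj q =>
    simp only [Walk.support_cons, List.tail_cons, Walk.length_cons] at hch hnd hall hlen
    have hq : q.support = q.support.dropLast ++ [(⟨y, by simpa using hxy⟩ : ({x}ᶜ : Set α))] := by
      conv_lhs => rw [← List.dropLast_append_getLast q.support_ne_nil]
      simp
    have hl : q.support.dropLast.length = q.length := by simp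
    generalize q.support.dropLast = D at hq hl
    rw [hq] at hch hnd hall
    refine ⟨D.map Subtype.val, ?_, ?_, ?_, ?_⟩
    · have := (List.isChain_map (R := G.Adj) (Subtype.val : ({x}ᶜ : Set α) → α)).2
        (hch.imp (fun a b hab => by simpa using hab))
      simpa using this
    · have h2 := hnd.map (Subtype.val_injective)
      rw [List.map_append, List.map_singleton] at h2
      exact (List.perm_append_singleton _ _).nodup_iff.1 h2
    · simp; omega
    · intro t
      constructor
      · intro ht
        simp only [List.mem_cons, List.mem_map] at ht
        rcases ht with rfl | ⟨s, _, rfl⟩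
        · exact hxy
        · exact s.2
      · intro ht
        have := hall ⟨t, ht⟩
        simp only [List.mem_append, List.mem_singleton] at this
        rcases this with h | h
        · exact List.mem_cons_of_mem _ (List.mem_map.2 ⟨_, h, rfl⟩)
        · have h' : t = y := congrArg Subtype.val h
          simp [h']

theorem chain_const {α : Type*} (R : α → α → Prop) (S : α → Prop) (l : List α)
    (hc : List.IsChain R l) (hS : ∀ a ∈ l, ∀ b ∈ l, R a b → (S a ↔ S b)) :
    (∀ a ∈ l, S a) ∨ (∀ a ∈ l, ¬ S a) := by
  induction l with
  | nil => simp
  | cons a l ih =>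
    cases l with
    | nil => by_cases h : S a <;> simp [h]
    | cons b l =>
      rw [List.isChain_cons_cons] at hc
      have hab := hS a (by simp) b (by simp) hc.1
      rcases ih hc.2 (fun c hc d hd => hS c (List.mem_cons_of_mem _ hc) d
        (List.mem_cons_of_mem _ hd)) with h | h
      · left; intro c hc
        rcases List.mem_cons.1 hc with rfl | hc
        · exact hab.2 (h b (by simp))
        · exact h c hc
      · right; intro c hc
        rcases List.mem_cons.1 hc with rfl | hc
        · exact fun h' => h b (by simp) (hab.1 h')
        · exact h c hc

theorem side_path_s6 {α : Type*} [DecidableEq α] (G : SimpleGraph α) (x y z : α)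
    (hyx : y ≠ x) (hzx : z ≠ x) (hyz : y ≠ z)
    (h : IsHamiltonianGraph (G.induce ({x}ᶜ : Set α))) (S : α → Prop)
    (hS : ∀ a b, a ≠ x → a ≠ y → a ≠ z → b ≠ x → b ≠ y → b ≠ z → G.Adj a b → (S a ↔ S b))
    (hA : ∃ a, a ≠ x ∧ a ≠ y ∧ a ≠ z ∧ S a) (hB : ∃ a, a ≠ x ∧ a ≠ y ∧ a ≠ z ∧ ¬ S a) :
    ∃ L : List α, List.IsChain G.Adj (y :: (L ++ [z])) ∧ L.Nodup ∧
      ∀ t, t ∈ L ↔ (t ≠ x ∧ t ≠ y ∧ t ≠ z ∧ S t) := by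
  obtain ⟨L, hch, hnd, -, hmem⟩ := ham_list G x y hyx h
  have hz : z ∈ L := by
    have := (hmem z).2 hzx
    simpa [hyz.symm] using this
  obtain ⟨L1, L2, rfl⟩ := List.append_of_mem hz
  have hch' : List.IsChain G.Adj ((y :: L1) ++ z :: (L2 ++ [y])) := by simpa using hch
  obtain ⟨c1, c2⟩ := List.isChain_split.1 hch'
  have m1 : ∀ t ∈ L1, t ≠ x ∧ t ≠ y ∧ t ≠ z := by
    intro t ht
    have := (hmem t).1 (by simp [ht])
    grind
  have m2 : ∀ t ∈ L2, t ≠ x ∧ t ≠ y ∧ t ≠ z := by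
    intro t ht
    have := (hmem t).1 (by simp [ht])
    grind
  have k1 : List.IsChain G.Adj L1 := by
    have := c1.tail
    exact (List.isChain_append.1 this).1
  have k2 : List.IsChain G.Adj L2 := by
    have := c2.tail
    exact (List.isChain_append.1 this).1
  have d1 := chain_const G.Adj S L1 k1 (fun a ha b hb hab => hS a b (m1 a ha).1 (m1 a ha).2.1
    (m1 a ha).2.2 (m1 b hb).1 (m1 b hb).2.1 (m1 b hb).2.2 hab)
  have d2 := chain_const G.Adj S L2 k2 (fun a ha b hb hab => hS a b (m2 a ha).1 (m2 a ha).2.1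
    (m2 a ha).2.2 (m2 b hb).1 (m2 b hb).2.1 (m2 b hb).2.2 hab)
  have hor : ∀ t, t ≠ x → t ≠ y → t ≠ z → t ∈ L1 ∨ t ∈ L2 := by
    intro t h1 h2 h3
    have := (hmem t).2 h1
    grind
  have n1 : L1.Nodup := by grind
  have n2 : L2.Nodup := by grind
  obtain ⟨a, a1, a2, a3, a4⟩ := hA
  obtain ⟨b, b1, b2, b3, b4⟩ := hB
  have hna := hor a a1 a2 a3
  have hnb := hor b b1 b2 b3
  rcases d1 with d1 | d1 <;> rcases d2 with d2 | d2
  · grind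
  · exact ⟨L1, by simpa using c1, n1, by grind⟩
  · refine ⟨L2.reverse, ?_, by simpa using n2, by grind⟩
    have := List.isChain_reverse.2 (c2.imp (fun a b hab => hab.symm) : List.IsChain (flip G.Adj) _)
    simpa [flip] using this
  · grind

theorem walk_of_chain {α : Type*} (G : SimpleGraph α) (u v : α) (l : List α) (hne : l ≠ [])
    (hc : List.IsChain G.Adj l) (hu : l.head hne = u) (hv : l.getLast hne = v) :
    ∃ p : G.Walk u v, p.support = l := by
  subst hu hv
  exact ⟨Walk.ofSupport l hne hc, Walk.support_ofSupport hne hc⟩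

theorem cut_aux {α : Type*} [Fintype α] [DecidableEq α] (G : SimpleGraph α)
    (hG : Hypohamiltonian G) (u v w : α) (huv : u ≠ v) (hvw : v ≠ w) (huw : u ≠ w) (S : α → Prop)
    (hS : ∀ a b, a ∉ ({u, v, w} : Set α) → b ∉ ({u, v, w} : Set α) → G.Adj a b → (S a ↔ S b))
    (hA : ∃ a, a ∉ ({u, v, w} : Set α) ∧ S a) (hB : ∃ a, a ∉ ({u, v, w} : Set α) ∧ ¬ S a) :
    ¬ G.Adj u v := by
  intro hadj
  obtain ⟨-, hn, hham⟩ := hG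
  simp only [Set.mem_insert_iff, Set.mem_singleton_iff, not_or] at hS hA hB
  obtain ⟨LA, cA, nA, mA⟩ := side_path_s6 G v u w huv hvw.symm huw (hham v) S
    (by grind) (by grind) (by grind)
  obtain ⟨LB, cB, nB, mB⟩ := side_path_s6 G u w v huw.symm huv.symm hvw.symm (hham u)
    (fun t => ¬ S t) (by grind) (by grind) (by grind)
  apply hn
  have hc : List.IsChain G.Adj ((u :: LA) ++ w :: (LB ++ [v])) :=
    List.isChain_split.2 ⟨by simpa using cA, cB⟩
  have hnd : ((u :: LA) ++ w :: (LB ++ [v])).Nodup := by grind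
  have hall : ∀ t, t ∈ ((u :: LA) ++ w :: (LB ++ [v])) := by grind
  have hlen : 3 ≤ ((u :: LA) ++ w :: (LB ++ [v])).length := by simp; omega
  obtain ⟨p, hp⟩ : ∃ p : G.Walk u v, p.support = (u :: LA) ++ w :: (LB ++ [v]) :=
    walk_of_chain G u v _ (by simp) hc (by simp) (by simp)
  rw [← hp] at hnd hall hlen
  rw [Walk.length_support] at hlen
  have hpath : p.IsPath := Walk.IsPath.mk' hnd
  refine ⟨v, Walk.cons hadj.symm p, ?_⟩
  rw [Walk.isHamiltonianCycle_iff_isCycle_and_support_count_tail_eq_one]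
  refine ⟨(Walk.cons_isCycle_iff _ _).2 ⟨hpath, fun he => ?_⟩, fun a => ?_⟩
  · rw [Sym2.eq_swap] at he
    have := hpath.length_eq_one_of_mem_edges he
    omega
  · simpa using List.count_eq_one_of_mem hnd (hall a)

theorem hypohamiltonian_three_cut_independent {α : Type*} [Fintype α] [DecidableEq α]
    (G : SimpleGraph α) (hG : Hypohamiltonian G)
    (u v w : α) (huv : u ≠ v) (hvw : v ≠ w) (huw : u ≠ w)
    (hcut : ¬ (G.induce ({u, v, w}ᶜ : Set α)).Connected) :
    ¬ G.Adj u v ∧ ¬ G.Adj v w ∧ ¬ G.Adj u w := by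
  have hne : Nonempty (({u, v, w}ᶜ : Set α) : Type _) := by
    by_contra hemp
    obtain ⟨L, -, hnd, hl, hm⟩ := ham_list G u v huv.symm (hG.2.2 u)
    have hsub : ∀ t ∈ L, t = w := by
      intro t ht
      have h1 : t ≠ u := (hm t).1 (by simp [ht])
      have h2 : t ≠ v := by grind
      by_contra h3
      exact hemp ⟨⟨t, by simp [h1, h2, h3]⟩⟩
    match L, hl with
    | a :: b :: L, _ =>
      have h1 := hsub a (by simp)
      have h2 := hsub b (by simp)
      simp [h1, h2] at hnd
  have hpre : ¬ (G.induce ({u, v, w}ᶜ : Set α)).Preconnected := fun h => hcut ⟨h⟩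
  unfold SimpleGraph.Preconnected at hpre
  push Not at hpre
  obtain ⟨a, b, hab⟩ := hpre
  let S : α → Prop := fun x => ∃ h : x ∈ ({u, v, w}ᶜ : Set α),
    (G.induce ({u, v, w}ᶜ : Set α)).Reachable a ⟨x, h⟩
  have hS : ∀ c d, c ∉ ({u, v, w} : Set α) → d ∉ ({u, v, w} : Set α) → G.Adj c d →
      (S c ↔ S d) := by
    intro c d hc hd hcd
    have had : (G.induce ({u, v, w}ᶜ : Set α)).Adj ⟨c, hc⟩ ⟨d, hd⟩ := by simpa using hcd
    exact ⟨fun ⟨_, h⟩ => ⟨hd, h.trans had.reachable⟩,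
      fun ⟨_, h⟩ => ⟨hc, h.trans had.symm.reachable⟩⟩
  have hA : ∃ a, a ∉ ({u, v, w} : Set α) ∧ S a := ⟨a, a.2, a.2, Reachable.refl _⟩
  have hB : ∃ a, a ∉ ({u, v, w} : Set α) ∧ ¬ S a := ⟨b, b.2, fun ⟨_, h⟩ => hab h⟩
  have e1 : ({v, w, u} : Set α) = {u, v, w} := by ext; simp; tauto
  have e2 : ({u, w, v} : Set α) = {u, v, w} := by ext; simp; tauto
  exact ⟨cut_aux G hG u v w huv hvw huw S hS hA hB,
    cut_aux G hG v w u hvw huw.symm huv.symm S (by rwa [e1]) (by rwa [e1]) (by rwa [e1]),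
    cut_aux G hG u w v huw hvw.symm huv S (by rwa [e2]) (by rwa [e2]) (by rwa [e2])⟩
end

section
/- In a cubic hypohamiltonian graph, every 3-vertex-cut is the neighbourhood of some vertex. -/
open SimpleGraph

/-- Split a walk at the first step leaving `Y`. -/
lemma walk_split {α : Type*} {G : SimpleGraph α} (Y : Set α) :
    ∀ {u v : α} (r : G.Walk u v), u ∈ Y → (∃ z ∈ r.support, z ∉ Y) →
      ∃ (a b : α) (q : G.Walk u a) (h : G.Adj a b) (s : G.Walk b v),
        r = q.append (Walk.cons h s) ∧ (∀ z ∈ q.support, z ∈ Y) ∧ b ∉ Y := by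
  intro u v r
  induction r with
  | nil =>
    rintro hu ⟨z, hz, hzY⟩
    simp at hz
    subst hz
    exact absurd hu hzY
  | @cons u b v h p ih =>
    rintro hu ⟨z, hz, hzY⟩
    by_cases hb : b ∈ Y
    · have hz' : z ∈ p.support := by
        simp only [Walk.support_cons, List.mem_cons] at hz
        rcases hz with rfl | hz
        · exact absurd hu hzY
        · exact hz
      obtain ⟨a, b', q, h', s, e, hq, hb'⟩ := ih hb ⟨z, hz', hzY⟩
      refine ⟨a, b', Walk.cons h q, h', s, ?_, ?_, hb'⟩
      · rw [e]; rfl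
      · intro t ht
        simp only [Walk.support_cons, List.mem_cons] at ht
        rcases ht with rfl | ht
        · exact hu
        · exact hq t ht
    · refine ⟨u, b, Walk.nil, h, p, rfl, ?_, hb⟩
      intro t ht
      simp at ht
      rw [ht]; exact hu

/-- A Hamiltonian cycle of a vertex-deleted subgraph, as a cycle of `G`. -/
lemma cycle_of_deleted {α : Type*} [DecidableEq α] (G : SimpleGraph α) (v : α)
    (h : IsHamiltonianGraph (G.induce ({v}ᶜ : Set α))) :
    ∃ (a : α) (c : G.Walk a a), c.IsCycle ∧ ∀ z, z ∈ c.support ↔ z ≠ v := by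
  obtain ⟨a, c, hc⟩ := h
  refine ⟨(Embedding.induce (G := G) ({v}ᶜ : Set α)).toHom a,
    c.map (Embedding.induce (G := G) ({v}ᶜ : Set α)).toHom, ?_, ?_⟩
  · exact hc.isCycle.map (Embedding.induce (G := G) ({v}ᶜ : Set α)).injective
  · intro z
    rw [Walk.support_map]
    constructor
    · intro hz
      obtain ⟨t, _, rfl⟩ := List.mem_map.1 hz
      exact t.2
    · intro hz
      exact List.mem_map.2 ⟨⟨z, hz⟩, hc.mem_support _, rfl⟩

/-- A cycle crossing a cut through (at most) two edges yields a spanning path of one side. -/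
lemma core_oriented {α : Type*} (G : SimpleGraph α) (Y : Set α)
    {a b : α} (h : G.Adj a b) (r : G.Walk b a) (hr : r.IsPath) (he : s(a, b) ∉ r.edges)
    (ha : a ∉ Y) (hb : b ∈ Y) (hY : ∀ z ∈ Y, z ∈ r.support) (x' y' : α)
    (hcr : ∀ x y, x ∉ Y → y ∈ Y → x ∈ r.support → G.Adj x y →
      (x = a ∧ y = b) ∨ (x = x' ∧ y = y')) :
    G.Adj x' y' ∧ ∃ q : G.Walk b y', q.IsPath ∧ ∀ z, z ∈ q.support ↔ z ∈ Y := by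
  obtain ⟨c, d, q, hcd, s, e, hq, hd⟩ := walk_split Y r hb ⟨a, r.end_mem_support, ha⟩
  have hcY : c ∈ Y := hq _ q.end_mem_support
  have hdr : d ∈ r.support := by rw [e]; simp
  have hnd := hr.support_nodup
  have hsupp : r.support = q.support ++ s.support := by
    rw [e, Walk.support_append]; simp
  rcases hcr d c hd hcY hdr hcd.symm with ⟨rfl, rfl⟩ | ⟨rfl, rfl⟩
  · exfalso
    apply he
    rw [e]
    simp [Sym2.eq_swap]
  · refine ⟨hcd.symm, q, ?_, ?_⟩
    · rw [Walk.isPath_def]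
      rw [hsupp] at hnd
      exact (List.nodup_append.1 hnd).1
    · intro z
      refine ⟨hq z, fun hz => ?_⟩
      by_contra hzq
      have hzs : z ∈ s.support := by
        have := hY z hz
        rw [hsupp, List.mem_append] at this
        tauto
      obtain ⟨f, g, q', hfg, s', e', hq', hg⟩ :=
        walk_split Yᶜ s hd ⟨z, hzs, by simpa using hz⟩
      have hgY : g ∈ Y := by simpa using hg
      have hgs : g ∈ s.support := by rw [e']; simp
      have hfs : f ∈ s.support := by rw [e']; simp
      have hfY : f ∉ Y := hq' _ q'.end_mem_support
      rw [hsupp] at hnd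
      have hdis := (List.nodup_append'.1 hnd).2.2
      have hgq : g ∉ q.support := fun hh => hdis hh hgs
      rcases hcr f g hfY hgY (by rw [hsupp]; simp [hfs]) hfg with ⟨_, rfl⟩ | ⟨_, rfl⟩
      · exact hgq q.start_mem_support
      · exact hgq q.end_mem_support

lemma core {α : Type*} [DecidableEq α] (G : SimpleGraph α) (Y : Set α)
    {o : α} (c : G.Walk o o) (hc : c.IsCycle) (hX : ∃ x ∈ c.support, x ∉ Y)
    (hYne : Y.Nonempty) (hY : ∀ z ∈ Y, z ∈ c.support) (x₂ y₂ x₃ y₃ : α)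
    (hcr : ∀ x y, x ∉ Y → y ∈ Y → x ∈ c.support → G.Adj x y →
      (x = x₂ ∧ y = y₂) ∨ (x = x₃ ∧ y = y₃)) :
    G.Adj x₂ y₂ ∧ G.Adj x₃ y₃ ∧
      ∃ q : G.Walk y₂ y₃, q.IsPath ∧ ∀ z, z ∈ q.support ↔ z ∈ Y := by
  obtain ⟨x, hxc, hxY⟩ := hX
  obtain ⟨y, hy⟩ := hYne
  have hc' := hc.rotate hxc
  have hmem : ∀ z, z ∈ (c.rotate x hxc).support ↔ z ∈ c.support := by
    intro z
    exact Walk.mem_support_rotate_iff c x hxc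
  generalize c.rotate x hxc = c' at hc' hmem
  obtain ⟨a, b, q, hab, s, e, hq, hb⟩ :=
    walk_split Yᶜ c' hxY ⟨y, (hmem y).2 (hY y hy), by simpa using hy⟩
  have hb : b ∈ Y := by simpa using hb
  have ha : a ∉ Y := hq _ q.end_mem_support
  have hpath : (s.append q).IsPath := by
    rw [Walk.isPath_def, Walk.support_append]
    have := hc'.support_nodup
    rw [e, Walk.support_append, Walk.support_cons, List.tail_cons,
      List.tail_append_of_ne_nil (by simp)] at this
    exact (List.perm_append_comm.nodup_iff).1 this
  have hedge : s(a, b) ∉ (s.append q).edges := by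
    have := hc'.edges_nodup
    rw [e, Walk.edges_append, Walk.edges_cons] at this
    rw [Walk.edges_append, List.mem_append]
    have h1 := List.nodup_middle.1 this
    have h2 := (List.nodup_cons.1 h1).1
    rw [List.mem_append] at h2
    tauto
  have hm : ∀ z, z ∈ (s.append q).support ↔ z ∈ c.support := by
    intro z
    rw [← hmem, e, Walk.mem_support_append_iff, Walk.mem_support_append_iff, Walk.support_cons,
      List.mem_cons]
    have := q.end_mem_support
    constructor
    · tauto
    · rintro (h | rfl | h) <;> tauto
  have hY' : ∀ z ∈ Y, z ∈ (s.append q).support := fun z hz => (hm z).2 (hY z hz)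
  rcases hcr a b ha hb ((hm a).1 (Walk.end_mem_support _)) hab with ⟨rfl, rfl⟩ | ⟨rfl, rfl⟩
  · obtain ⟨h1, h2⟩ := core_oriented G Y hab (s.append q) hpath hedge ha hb hY' x₃ y₃
      (fun x y h1 h2 h3 h4 => hcr x y h1 h2 ((hm x).1 h3) h4)
    exact ⟨hab, h1, h2⟩
  · obtain ⟨h1, p, hp, hpY⟩ := core_oriented G Y hab (s.append q) hpath hedge ha hb hY' x₂ y₂
      (fun x y h1 h2 h3 h4 => (hcr x y h1 h2 ((hm x).1 h3) h4).symm)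
    exact ⟨h1, hab, p.reverse, hp.reverse, by simpa using hpY⟩

/-- Gluing spanning paths of the two sides. -/
lemma glue_s8 {α : Type*} [DecidableEq α] (G : SimpleGraph α) (X : Set α)
    {x₂ x₃ y₂ y₃ : α} (h2 : G.Adj x₂ y₂) (h3 : G.Adj x₃ y₃)
    (p : G.Walk x₂ x₃) (hp : p.IsPath) (hpX : ∀ z, z ∈ p.support ↔ z ∈ X)
    (q : G.Walk y₂ y₃) (hq : q.IsPath) (hqX : ∀ z, z ∈ q.support ↔ z ∉ X)
    (hX : ∃ z ∈ X, z ≠ x₂) : IsHamiltonianGraph G := by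
  have hsupp : (p.append (Walk.cons h3 q.reverse)).support = p.support ++ q.support.reverse := by
    rw [Walk.support_append]; simp
  have hpath : (p.append (Walk.cons h3 q.reverse)).IsPath := by
    rw [Walk.isPath_def, hsupp]
    refine List.nodup_append'.2 ⟨hp.support_nodup, List.nodup_reverse.2 hq.support_nodup, ?_⟩
    intro z hz hz'
    rw [List.mem_reverse] at hz'
    exact (hqX z).1 hz' ((hpX z).1 hz)
  have hx2 : x₂ ∈ X := (hpX _).1 p.start_mem_support
  have hx3 : x₃ ∈ X := (hpX _).1 p.end_mem_support
  have hy2 : y₂ ∉ X := (hqX _).1 q.start_mem_support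
  have hy3 : y₃ ∉ X := (hqX _).1 q.end_mem_support
  have hne : x₂ ≠ x₃ := by
    rintro rfl
    obtain ⟨z, hz, hzx⟩ := hX
    have := (hpX z).2 hz
    have hp := Walk.nil_iff_eq_nil.1 (Walk.isPath_iff_nil.1 hp)
    subst hp
    simp at this
    exact hzx this
  refine ⟨y₂, Walk.cons h2.symm (p.append (Walk.cons h3 q.reverse)), ?_⟩
  have hcyc : (Walk.cons h2.symm (p.append (Walk.cons h3 q.reverse))).IsCycle := by
    rw [Walk.cons_isCycle_iff]
    refine ⟨hpath, ?_⟩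
    rw [Walk.edges_append, Walk.edges_cons, List.mem_append, List.mem_cons]
    rintro (h | h | h)
    · exact hy2 ((hpX _).1 (p.fst_mem_support_of_mem_edges h))
    · rw [Sym2.eq_iff] at h
      rcases h with ⟨h, _⟩ | ⟨_, h⟩
      · exact hy2 (h ▸ hx3)
      · exact hne h
    · have := q.reverse.snd_mem_support_of_mem_edges h
      rw [Walk.support_reverse, List.mem_reverse] at this
      exact (hqX _).1 this hx2
  rw [Walk.isHamiltonianCycle_iff_isCycle_and_support_count_tail_eq_one]
  refine ⟨hcyc, fun z => ?_⟩
  rw [Walk.support_cons, List.tail_cons]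
  refine List.count_eq_one_of_mem hpath.support_nodup ?_
  rw [hsupp, List.mem_append, List.mem_reverse, hpX, hqX]
  tauto

lemma no_three_edge_cut {α : Type*} [Fintype α] [DecidableEq α] (G : SimpleGraph α)
    (hG : Hypohamiltonian G) (X : Set α) (e : Fin 3 → α × α)
    (hX : ∃ a ∈ X, ∃ a' ∈ X, a ≠ a') (hY : ∃ a ∉ X, ∃ a' ∉ X, a ≠ a')
    (he : ∀ i, (e i).1 ∈ X ∧ (e i).2 ∉ X)
    (hcr : ∀ x y, x ∈ X → y ∉ X → G.Adj x y → ∃ i, e i = (x, y)) : False := by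
  obtain ⟨_, hnot, hdel⟩ := hG
  obtain ⟨a, ha, a', ha', haa⟩ := hX
  obtain ⟨b, hb, b', hb', hbb⟩ := hY
  have hexX : ∀ t, ∃ z ∈ X, z ≠ t := by
    intro t
    by_cases h : a = t
    · exact ⟨a', ha', fun h' => haa (h.trans h'.symm)⟩
    · exact ⟨a, ha, h⟩
  have hexY : ∀ t, ∃ z ∉ X, z ≠ t := by
    intro t
    by_cases h : b = t
    · exact ⟨b', hb', fun h' => hbb (h.trans h'.symm)⟩
    · exact ⟨b, hb, h⟩
  have hcr' : ∀ x y, x ∈ X → y ∉ X → G.Adj x y → (x ≠ (e 0).1 ∨ y ≠ (e 0).2) →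
      (x = (e 1).1 ∧ y = (e 1).2) ∨ (x = (e 2).1 ∧ y = (e 2).2) := by
    intro x y hx hy hxy hne
    obtain ⟨i, hi⟩ := hcr x y hx hy hxy
    fin_cases i
    · simp at hi
      simp [hi] at hne
    · left; simp at hi; simp [hi]
    · right; simp at hi; simp [hi]
  obtain ⟨o, c, hc, hcs⟩ := cycle_of_deleted G (e 0).1 (hdel _)
  obtain ⟨o', c', hc', hcs'⟩ := cycle_of_deleted G (e 0).2 (hdel _)
  obtain ⟨z, hz, hz0⟩ := hexX (e 0).1
  obtain ⟨h2, h3, q, hq, hqX⟩ := core G Xᶜ c hc ⟨z, (hcs z).2 hz0, by simpa using hz⟩ ⟨b, hb⟩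
    (fun t ht => (hcs t).2 (fun h => ht (h ▸ (he 0).1))) (e 1).1 (e 1).2 (e 2).1 (e 2).2
    (fun x y hx hy hxc hxy => hcr' x y (by simpa using hx) hy hxy (Or.inl ((hcs x).1 hxc)))
  obtain ⟨z', hz', hz0'⟩ := hexY (e 0).2
  obtain ⟨-, -, p, hp, hpX⟩ := core G X c' hc' ⟨z', (hcs' z').2 hz0', hz'⟩ ⟨a, ha⟩
    (fun t ht => (hcs' t).2 (fun h => (he 0).2 (h ▸ ht))) (e 1).2 (e 1).1 (e 2).2 (e 2).1
    (fun x y hx hy hxc hxy => by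
      have := hcr' y x hy hx hxy.symm (Or.inr ((hcs' x).1 hxc))
      tauto)
  exact hnot (glue_s8 G X h2 h3 p hp hpX q hq hqX (hexX _))

open Finset in
/-- The cost of a 2-colouring, localized at a vertex. -/
lemma cost_decomp {α : Type*} [Fintype α] [DecidableEq α] (G : SimpleGraph α)
    [DecidableRel G.Adj] (f : α → Bool) (s : α) :
    #{p : α × α | G.Adj p.1 p.2 ∧ f p.1 ≠ f p.2} =
      #{p : α × α | G.Adj p.1 p.2 ∧ f p.1 ≠ f p.2 ∧ p.1 ≠ s ∧ p.2 ≠ s} +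
        2 * #{y ∈ G.neighborFinset s | f y ≠ f s} := by
  set K := {y ∈ G.neighborFinset s | f y ≠ f s} with hK
  set D : Finset (α × α) := {p : α × α | G.Adj p.1 p.2 ∧ f p.1 ≠ f p.2 ∧ p.1 ≠ s ∧ p.2 ≠ s} with hD
  have h1 : ({p : α × α | G.Adj p.1 p.2 ∧ f p.1 ≠ f p.2} : Finset (α × α)) =
      (D ∪ ({s} ×ˢ K)) ∪ (K ×ˢ {s}) := by
    ext ⟨x, y⟩
    simp only [hK, hD, mem_union, mem_filter, mem_univ, true_and, mem_product, mem_singleton,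
      mem_neighborFinset]
    by_cases hx : x = s
    · subst hx
      by_cases hy : y = x
      · subst hy; simp
      · simp [hy, eq_comm]
    · by_cases hy : y = s
      · subst hy; simp [hx, G.adj_comm]
      · simp [hx, hy]
  rw [h1, card_union_of_disjoint, card_union_of_disjoint, card_product, card_product,
    card_singleton]
  · ring
  · rw [Finset.disjoint_left]
    rintro ⟨x, y⟩ h h'
    simp only [hD, mem_filter, mem_product, mem_singleton] at h h'
    tauto
  · rw [Finset.disjoint_left]
    rintro ⟨x, y⟩ h h'
    simp only [hD, hK, mem_union, mem_filter, mem_product, mem_singleton, mem_neighborFinset] at h h'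
    obtain ⟨⟨h1, h2⟩, rfl⟩ := h'
    rcases h with h | h
    · tauto
    · obtain ⟨rfl, -⟩ := h
      simp at h1

open Finset in
lemma min_cut {α : Type*} [Fintype α] [DecidableEq α] (G : SimpleGraph α)
    [DecidableRel G.Adj] (hcubic : ∀ x : α, G.degree x = 3) (A B : Set α) (hAB : Disjoint A B) :
    ∃ f : α → Bool, (∀ a ∈ A, f a = true) ∧ (∀ b ∈ B, f b = false) ∧
      ∀ s, s ∉ A → s ∉ B → #{y ∈ G.neighborFinset s | f y ≠ f s} ≤ 1 := by
  classical
  obtain ⟨f, hf, hmin⟩ := Finset.exists_min_image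
    ({f : α → Bool | (∀ a ∈ A, f a = true) ∧ (∀ b ∈ B, f b = false)} : Finset (α → Bool))
    (fun f => #{p : α × α | G.Adj p.1 p.2 ∧ f p.1 ≠ f p.2})
    ⟨fun z => decide (z ∈ A), by
      simp only [mem_filter, mem_univ, true_and, decide_eq_true_eq, decide_eq_false_iff_not]
      exact ⟨fun a h => h, fun b hb ha => Set.disjoint_left.1 hAB ha hb⟩⟩
  simp only [mem_filter, mem_univ, true_and] at hf
  refine ⟨f, hf.1, hf.2, fun s hsA hsB => ?_⟩
  have hm := hmin (Function.update f s (!f s)) (by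
    simp only [mem_filter, mem_univ, true_and]
    refine ⟨fun a ha => ?_, fun b hb => ?_⟩
    · rw [Function.update_of_ne (by rintro rfl; exact hsA ha)]; exact hf.1 a ha
    · rw [Function.update_of_ne (by rintro rfl; exact hsB hb)]; exact hf.2 b hb)
  rw [cost_decomp G f s, cost_decomp G (Function.update f s (!f s)) s] at hm
  have hD : (Finset.univ.filter fun p : α × α => G.Adj p.1 p.2 ∧ Function.update f s (!f s) p.1 ≠
        Function.update f s (!f s) p.2 ∧ p.1 ≠ s ∧ p.2 ≠ s) =
      Finset.univ.filter fun p : α × α => G.Adj p.1 p.2 ∧ f p.1 ≠ f p.2 ∧ p.1 ≠ s ∧ p.2 ≠ s := by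
    ext ⟨x, y⟩
    simp only [mem_filter, mem_univ, true_and]
    by_cases hx : x = s
    · simp [hx]
    · by_cases hy : y = s
      · simp [hy]
      · simp [hx, hy]
  have hK : ({y ∈ G.neighborFinset s | Function.update f s (!f s) y ≠
      Function.update f s (!f s) s} : Finset α) =
      {y ∈ G.neighborFinset s | ¬ (f y ≠ f s)} := by
    ext y
    simp only [mem_filter, mem_neighborFinset]
    by_cases hy : y = s
    · simp [hy]
    · simp [hy]
  rw [hD, hK] at hm
  have h3 := Finset.card_filter_add_card_filter_not (s := G.neighborFinset s) (fun y => f y ≠ f s)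
  rw [card_neighborFinset_eq_degree, hcubic] at h3
  omega

/-- A vertex all of whose neighbours lie in `{u, v, w}`. -/
lemma nbhd_eq {α : Type*} [Fintype α] [DecidableEq α]
    (G : SimpleGraph α) [DecidableRel G.Adj] (hcubic : ∀ x : α, G.degree x = 3)
    (u v w x : α) (h : ∀ y, G.Adj x y → y ∈ ({u, v, w} : Set α)) :
    G.neighborSet x = {u, v, w} := by
  have hsub : G.neighborFinset x ⊆ ({u, v, w} : Finset α) := by
    intro y hy
    have := h y ((G.mem_neighborFinset x y).1 hy)
    simpa using this
  have heq := Finset.eq_of_subset_of_card_le hsub (by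
    rw [card_neighborFinset_eq_degree, hcubic]; exact Finset.card_le_three)
  ext y
  rw [mem_neighborSet, ← mem_neighborFinset, heq]
  simp

theorem cubic_hypohamiltonian_three_cut_is_neighborhood {α : Type*} [Fintype α] [DecidableEq α]
    (G : SimpleGraph α) [DecidableRel G.Adj] (hcubic : ∀ x : α, G.degree x = 3)
    (hG : Hypohamiltonian G)
    (u v w : α) (huv : u ≠ v) (hvw : v ≠ w) (huw : u ≠ w)
    (hcut : ¬ (G.induce ({u, v, w}ᶜ : Set α)).Connected) :
    ∃ x : α, G.neighborSet x = {u, v, w} := by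
  classical
  by_cases hne : Nonempty (({u, v, w}ᶜ : Set α) : Type _)
  swap
  · refine ⟨u, nbhd_eq G hcubic u v w u fun y _ => ?_⟩
    by_contra hy
    exact hne ⟨⟨y, hy⟩⟩
  have hpre : ¬ (G.induce ({u, v, w}ᶜ : Set α)).Preconnected := fun h => hcut ⟨h⟩
  unfold SimpleGraph.Preconnected at hpre
  push Not at hpre
  obtain ⟨a, b, hab⟩ := hpre
  generalize hS : ({u, v, w} : Set α) = S at *
  set A : Set α := {z | ∃ h : z ∈ Sᶜ, (G.induce Sᶜ).Reachable a ⟨z, h⟩} with hA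
  set B : Set α := {z | z ∉ S ∧ z ∉ A} with hB
  have haA : (a : α) ∈ A := ⟨a.2, Reachable.refl _⟩
  have hbB : (b : α) ∈ B := ⟨b.2, fun ⟨_, h⟩ => hab h⟩
  have hdisj : Disjoint A B := Set.disjoint_left.2 fun z hz hz' => hz'.2 hz
  have hno : ∀ x ∈ A, ∀ y ∈ B, ¬ G.Adj x y := by
    rintro x ⟨hx, hr⟩ y ⟨hyS, hyA⟩ hxy
    refine hyA ⟨hyS, hr.trans (Adj.reachable ?_)⟩
    exact hxy
  have hcase : ∀ z, z ∈ A ∨ z ∈ B ∨ z ∈ S := by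
    intro z
    by_cases h1 : z ∈ S
    · tauto
    · by_cases h2 : z ∈ A
      · tauto
      · exact Or.inr (Or.inl ⟨h1, h2⟩)
  by_contra hcon
  have hA2 : ∃ a' ∈ A, (a : α) ≠ a' := by
    by_contra hh
    push Not at hh
    refine hcon ⟨a, (nbhd_eq G hcubic u v w a fun y hy => ?_).trans hS⟩
    rw [hS]
    rcases hcase y with h | h | h
    · exact absurd (hh y h) hy.ne
    · exact absurd hy (hno _ haA _ h)
    · exact h
  have hB2 : ∃ b' ∈ B, (b : α) ≠ b' := by
    by_contra hh
    push Not at hh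
    refine hcon ⟨b, (nbhd_eq G hcubic u v w b fun y hy => ?_).trans hS⟩
    rw [hS]
    rcases hcase y with h | h | h
    · exact absurd hy.symm (hno _ h _ hbB)
    · exact absurd (hh y h) hy.ne
    · exact h
  obtain ⟨a', ha', haa⟩ := hA2
  obtain ⟨b', hb', hbb⟩ := hB2
  obtain ⟨f, hfA, hfB, hf⟩ := min_cut G hcubic A B hdisj
  have hSA : ∀ s ∈ S, s ∉ A := fun s hs ⟨h, _⟩ => h hs
  have hSB : ∀ s ∈ S, s ∉ B := fun s hs h => h.1 hs
  -- every cut vertex carries at most one crossing edge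
  have key : ∀ s ∈ S, ∃ e : α × α, (f e.1 = true ∧ f e.2 ≠ true) ∧
      ∀ x y, f x = true → f y ≠ true → G.Adj x y → (x = s ∨ y = s) → e = (x, y) := by
    intro s hs
    have h1 := Finset.card_le_one.1 (hf s (hSA s hs) (hSB s hs))
    simp only [Finset.mem_filter, mem_neighborFinset] at h1
    by_cases hex : ∃ x y, f x = true ∧ f y ≠ true ∧ G.Adj x y ∧ (x = s ∨ y = s)
    · obtain ⟨x, y, hx, hy, hxy, hs'⟩ := hex
      refine ⟨(x, y), ⟨hx, hy⟩, fun x' y' hx' hy' hxy' hs'' => ?_⟩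
      rcases hs' with rfl | rfl <;> rcases hs'' with rfl | rfl
      · rw [h1 y ⟨hxy, by rw [hx]; exact hy⟩ y' ⟨hxy', by rw [hx]; exact hy'⟩]
      · exact absurd hx hy'
      · exact absurd hx' hy
      · rw [h1 x ⟨hxy.symm, by rw [hx]; exact Ne.symm hy⟩ x'
          ⟨hxy'.symm, by rw [hx']; exact Ne.symm hy⟩]
    · refine ⟨(a, b), ⟨hfA _ haA, by simp [hfB _ hbB]⟩, fun x y hx hy hxy hs' => ?_⟩
      exact absurd ⟨x, y, hx, hy, hxy, hs'⟩ hex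
  obtain ⟨e0, he0, hc0⟩ := key u (by simp [← hS])
  obtain ⟨e1, he1, hc1⟩ := key v (by simp [← hS])
  obtain ⟨e2, he2, hc2⟩ := key w (by simp [← hS])
  refine no_three_edge_cut G hG {z | f z = true} ![e0, e1, e2]
    ⟨a, hfA _ haA, a', hfA _ ha', haa⟩
    ⟨b, by simp [hfB _ hbB], b', by simp [hfB _ hb'], hbb⟩ ?_ ?_
  · intro i
    fin_cases i
    · exact he0
    · exact he1
    · exact he2
  · intro x y hx hy hxy
    have hin : x ∈ S ∨ y ∈ S := by
      by_contra hh
      push Not at hh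
      have hxA : x ∈ A := by
        rcases hcase x with h | h | h
        · exact h
        · have := hfB x h
          simp [this] at hx
        · exact absurd h hh.1
      have hyB : y ∈ B := by
        rcases hcase y with h | h | h
        · exact absurd (hfA y h) hy
        · exact h
        · exact absurd h hh.2
      exact hno x hxA y hyB hxy
    have : (x = u ∨ y = u) ∨ (x = v ∨ y = v) ∨ (x = w ∨ y = w) := by
      simp only [← hS, Set.mem_insert_iff, Set.mem_singleton_iff] at hin
      tauto
    rcases this with h | h | h
    · exact ⟨0, hc0 x y hx hy hxy h⟩
    · exact ⟨1, hc1 x y hx hy hxy h⟩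
    · exact ⟨2, hc2 x y hx hy hxy h⟩
end

section
/- A hypohamiltonian graph has at least 10 vertices. -/
open SimpleGraph

open Finset

/-- A cyclic enumeration of all vertices gives a hamiltonian cycle. -/
lemma isHamiltonianGraph_of_enum {α : Type*} [Fintype α] [DecidableEq α] (G : SimpleGraph α)
    (m : ℕ) (hm : 2 ≤ m) (hcard : Fintype.card α = m + 1) (d : ℕ → α)
    (hinj : ∀ i j, i ≤ m → j ≤ m → d i = d j → i = j)
    (hadj : ∀ i, i < m → G.Adj (d i) (d (i + 1))) (hlast : G.Adj (d m) (d 0)) :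
    IsHamiltonianGraph G := by
  have key : ∀ k, k ≤ m → ∃ p : G.Walk (d 0) (d k),
      p.length = k ∧ p.support = (List.range (k + 1)).map d := by
    intro k
    induction k with
    | zero => exact fun _ => ⟨Walk.nil, by simp⟩
    | succ k ih =>
      intro hk
      obtain ⟨p, hp, hs⟩ := ih (by omega)
      refine ⟨p.concat (hadj k (by omega)), by simp [hp], ?_⟩
      rw [Walk.support_concat, hs, List.range_succ (n := k + 1)]
      simp
  obtain ⟨p, hp, hs⟩ := key m le_rfl
  refine ⟨_, Walk.cons hlast p, ?_⟩
  rw [Walk.isHamiltonianCycle_iff_isCycle_and_length_eq]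
  refine ⟨?_, by simp [hp, hcard]⟩
  rw [Walk.isCycle_iff_isPath_tail_and_le_length]
  refine ⟨?_, by simp [hp]; omega⟩
  rw [Walk.isPath_def]
  rw [Walk.support_tail_of_not_nil _ Walk.not_nil_cons, Walk.support_cons, List.tail_cons, hs]
  refine List.Nodup.map_on ?_ List.nodup_range
  intro x hx y hy h
  simp only [List.mem_range] at hx hy
  exact hinj x y (by omega) (by omega) h

/-- A hamiltonian cycle of `G - v`, started at `a ≠ v`. -/
lemma exists_enum {α : Type*} [Fintype α] [DecidableEq α] (G : SimpleGraph α) (v a : α)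
    (hav : a ≠ v) (h : IsHamiltonianGraph (G.induce ({v}ᶜ : Set α))) :
    ∃ (m : ℕ) (c : ℕ → α), 3 ≤ m ∧ Fintype.card α = m + 1 ∧ c 0 = a ∧ c m = a ∧
      (∀ i, i < m → G.Adj (c i) (c (i + 1))) ∧
      (∀ i j, i < m → j < m → c i = c j → i = j) ∧
      (∀ i, c i ≠ v) ∧ (∀ w, w ≠ v → ∃ i, i < m ∧ c i = w) := by
  obtain ⟨b, p, hp⟩ := h
  have ha : (⟨a, hav⟩ : ({v}ᶜ : Set α)) ∈ p.support := hp.mem_support _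
  have hq : (p.rotate _ ha).IsHamiltonianCycle := hp.rotate _
  generalize p.rotate _ ha = q at hq
  have hlen := hq.length_eq
  have h3 := hq.isCycle.three_le_length
  have hc : Fintype.card α = q.length + 1 := by
    rw [hlen, Fintype.card_compl_set]
    have : 0 < Fintype.card α := Fintype.card_pos_iff.mpr ⟨v⟩
    simp
    omega
  refine ⟨q.length, fun i => (q.getVert i).1, h3, hc, by simp, by simp, ?_, ?_, ?_, ?_⟩
  · intro i hi
    exact q.adj_getVert_succ hi
  · intro i j hi hj hij
    exact hq.isCycle.getVert_injOn' (by rw [Set.mem_ofPred_eq]; omega)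
      (by rw [Set.mem_ofPred_eq]; omega) (Subtype.ext hij)
  · intro i
    exact (q.getVert i).2
  · intro w hw
    have hw' := hq.mem_support ⟨w, hw⟩
    rw [Walk.mem_support_iff_exists_getVert] at hw'
    obtain ⟨n, hn, hnl⟩ := hw'
    rcases Nat.lt_or_eq_of_le hnl with h | h
    · exact ⟨n, h, congrArg Subtype.val hn⟩
    · refine ⟨0, by omega, ?_⟩
      rw [h, Walk.getVert_length] at hn
      exact (congrArg Subtype.val q.getVert_zero).trans (congrArg Subtype.val hn)

lemma two_mul_card_indep {α : Type*} [Fintype α] [DecidableEq α] (G : SimpleGraph α)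
    (w a : α) (haw : a ≠ w) (h : IsHamiltonianGraph (G.induce ({w}ᶜ : Set α)))
    (I : Finset α) (hwI : w ∉ I) (hI : ∀ x ∈ I, ∀ y ∈ I, ¬ G.Adj x y) :
    2 * #I + 1 ≤ Fintype.card α := by
  obtain ⟨m, c, h3, hcard, hc0, hcm, hadj, hinj, hne, hsurj⟩ := exists_enum G w a haw h
  set J := (range m).filter (fun i => c i ∈ I) with hJ
  have h1 : J.image c = I := by
    ext x
    simp only [hJ, mem_image, mem_filter, mem_range]
    constructor
    · rintro ⟨i, ⟨_, h⟩, rfl⟩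
      exact h
    · intro hx
      obtain ⟨i, hi, rfl⟩ := hsurj x (by rintro rfl; exact hwI hx)
      exact ⟨i, ⟨hi, hx⟩, rfl⟩
  have hcI : #I = #J := by
    rw [← h1]
    refine card_image_of_injOn ?_
    intro i hi j hj hij
    simp only [hJ, coe_filter, mem_range, Set.mem_ofPred_eq] at hi hj
    exact hinj i j hi.1 hj.1 hij
  have hsucc : #(J.image (fun i => c (i + 1))) = #J := by
    refine card_image_of_injOn ?_
    intro i hi j hj hij
    simp only [hJ, coe_filter, mem_range, Set.mem_ofPred_eq] at hi hj
    simp only at hij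
    rcases Nat.lt_or_eq_of_le (Nat.succ_le_of_lt hi.1) with h1 | h1 <;>
    rcases Nat.lt_or_eq_of_le (Nat.succ_le_of_lt hj.1) with h2 | h2
    · have := hinj _ _ h1 h2 hij
      omega
    · have := hinj (i + 1) 0 h1 (by omega) (by
        rw [hij, hc0, ← hcm]; congr 1)
      omega
    · have := hinj (j + 1) 0 h2 (by omega) (by
        rw [← hij, hc0, ← hcm]; congr 1)
      omega
    · omega
  have hdisj : Disjoint I (J.image (fun i => c (i + 1))) := by
    rw [Finset.disjoint_left]
    intro x hx hx'
    simp only [hJ, mem_image, mem_filter, mem_range] at hx'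
    obtain ⟨i, ⟨hi, hiI⟩, rfl⟩ := hx'
    exact hI _ hiI _ hx (hadj i hi)
  have hw2 : w ∉ I ∪ J.image (fun i => c (i + 1)) := by
    simp only [mem_union, mem_image, not_or, not_exists, not_and]
    exact ⟨hwI, fun i _ => hne _⟩
  have := card_le_univ (insert w (I ∪ J.image (fun i => c (i + 1))))
  rw [card_insert_of_notMem hw2, card_union_of_disjoint hdisj] at this
  omega

/-- The neighbour `c i` of `v` and its successor are not both adjacent to `v`. -/
lemma not_adj_succ {α : Type*} [Fintype α] [DecidableEq α] (G : SimpleGraph α)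
    (hnot : ¬ IsHamiltonianGraph G) (v : α) (m : ℕ) (c : ℕ → α) (h3 : 3 ≤ m)
    (hcard : Fintype.card α = m + 1) (hcm : c m = c 0)
    (hadj : ∀ i, i < m → G.Adj (c i) (c (i + 1)))
    (hinj : ∀ i j, i < m → j < m → c i = c j → i = j)
    (hne : ∀ i, c i ≠ v) (i : ℕ) (hi : i < m) (hvi : G.Adj v (c i)) :
    ¬ G.Adj v (c (i + 1)) := by
  intro hvi'
  apply hnot
  let e : ℕ → ℕ := fun k => if k ≤ i + 1 then i + 1 - k else m + i + 1 - k
  have he : ∀ k, k ≠ 0 → k ≤ m → e k < m := by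
    intro k h0 hk
    simp only [e]
    split_ifs <;> omega
  refine isHamiltonianGraph_of_enum G m (by omega) hcard
    (fun k => if k = 0 then v else c (e k)) ?_ ?_ ?_
  · intro x y hx hy hxy
    by_cases hx0 : x = 0 <;> by_cases hy0 : y = 0
    · omega
    · simp only [hx0, hy0, if_true, if_false] at hxy
      exact absurd hxy.symm (hne _)
    · simp only [hx0, hy0, if_true, if_false] at hxy
      exact absurd hxy (hne _)
    · simp only [hx0, hy0, if_false] at hxy
      have := hinj _ _ (he x hx0 hx) (he y hy0 hy) hxy
      simp only [e] at this
      split_ifs at this <;> omega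
  · intro k hk
    by_cases hk0 : k = 0
    · subst hk0
      simpa [e] using hvi
    · simp only [hk0, if_false, Nat.succ_ne_zero]
      have hstep : ∀ s t, s < m → t = s + 1 → G.Adj (c t) (c s) := by
        rintro s t hs rfl
        exact (hadj s hs).symm
      by_cases h1 : k = i + 1
      · have e1 : e k = 0 := by simp [e, h1]
        have e2 : e (k + 1) = m - 1 := by simp only [e]; split_ifs <;> omega
        rw [e1, e2, ← hcm]
        exact hstep _ _ (by omega) (by omega)
      · apply hstep
        · exact he _ (by omega) (by omega)
        · simp only [e]; split_ifs <;> omega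
  · have hm0 : m ≠ 0 := by omega
    simp only [hm0, if_false, if_true]
    by_cases h1 : m ≤ i + 1
    · have e1 : e m = 0 := by simp only [e]; split_ifs; omega
      have e2 : i + 1 = m := by omega
      rw [e1, ← hcm, ← e2]
      exact hvi'.symm
    · have e1 : e m = i + 1 := by simp only [e]; split_ifs; omega
      rw [e1]
      exact hvi'.symm

/-- Successors of two neighbours of `v` are not adjacent. -/
lemma not_adj_succ_succ {α : Type*} [Fintype α] [DecidableEq α] (G : SimpleGraph α)
    (hnot : ¬ IsHamiltonianGraph G) (v : α) (m : ℕ) (c : ℕ → α) (h3 : 3 ≤ m)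
    (hcard : Fintype.card α = m + 1) (hcm : c m = c 0)
    (hadj : ∀ i, i < m → G.Adj (c i) (c (i + 1)))
    (hinj : ∀ i j, i < m → j < m → c i = c j → i = j)
    (hne : ∀ i, c i ≠ v) (i j : ℕ) (hij : i < j) (hj : j < m)
    (hvi : G.Adj v (c i)) (hvj : G.Adj v (c j)) :
    ¬ G.Adj (c (i + 1)) (c (j + 1)) := by
  intro hss
  apply hnot
  let e : ℕ → ℕ := fun k => if k ≤ i + 1 then i + 1 - k else
    if k ≤ i + m - j then m + i + 1 - k else k - (m - j)
  have he : ∀ k, k ≠ 0 → k ≤ m → e k < m := by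
    intro k h0 hk
    simp only [e]
    split_ifs <;> omega
  refine isHamiltonianGraph_of_enum G m (by omega) hcard
    (fun k => if k = 0 then v else c (e k)) ?_ ?_ ?_
  · intro x y hx hy hxy
    by_cases hx0 : x = 0 <;> by_cases hy0 : y = 0
    · omega
    · simp only [hx0, hy0, if_true, if_false] at hxy
      exact absurd hxy.symm (hne _)
    · simp only [hx0, hy0, if_true, if_false] at hxy
      exact absurd hxy (hne _)
    · simp only [hx0, hy0, if_false] at hxy
      have := hinj _ _ (he x hx0 hx) (he y hy0 hy) hxy
      simp only [e] at this
      split_ifs at this <;> omega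
  · intro k hk
    by_cases hk0 : k = 0
    · subst hk0
      simpa [e] using hvi
    · simp only [hk0, if_false, Nat.succ_ne_zero]
      have hstep : ∀ s t, s < m → t = s + 1 → G.Adj (c t) (c s) := by
        rintro s t hs rfl
        exact (hadj s hs).symm
      by_cases h2 : k = i + m - j
      · have e2 : e (k + 1) = i + 1 := by simp only [e]; split_ifs <;> omega
        rw [e2]
        by_cases h4 : j + 1 = m
        · have e1 : e k = 0 := by simp only [e]; split_ifs <;> omega
          rw [e1, ← hcm, ← h4]
          exact hss.symm
        · have e1 : e k = j + 1 := by simp only [e]; split_ifs <;> omega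
          rw [e1]
          exact hss.symm
      · by_cases h1 : k = i + 1
        · have e1 : e k = 0 := by simp [e, h1]
          have e2 : e (k + 1) = m - 1 := by simp only [e]; split_ifs <;> omega
          rw [e1, e2, ← hcm]
          exact hstep _ _ (by omega) (by omega)
        · by_cases h5 : k ≤ i + m - j
          · apply hstep
            · exact he _ (by omega) (by omega)
            · simp only [e]; split_ifs <;> omega
          · have e2 : e (k + 1) = e k + 1 := by simp only [e]; split_ifs <;> omega
            rw [e2]
            exact hadj _ (he _ hk0 (by omega))
  · have hm0 : m ≠ 0 := by omega
    simp only [hm0, if_false, if_true]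
    have e1 : e m = j := by simp only [e]; split_ifs <;> omega
    rw [e1]
    exact hvj.symm

lemma degree_bound {α : Type*} [Fintype α] [DecidableEq α]
    (G : SimpleGraph α) [DecidableRel G.Adj] (hG : Hypohamiltonian G) (v : α) :
    3 ≤ G.degree v ∧ 2 * G.degree v + 3 ≤ Fintype.card α := by
  obtain ⟨_, hnot, hham⟩ := hG
  -- some vertex different from `v`
  have hex : ∃ w, w ≠ v := by
    obtain ⟨b, _⟩ := hham v
    exact ⟨b.1, b.2⟩
  obtain ⟨w, hw⟩ := hex
  have hnb : ∃ u, G.Adj v u := by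
    obtain ⟨m, c, h3, hcard, hc0, hcm, hadj, -⟩ := exists_enum G w v hw.symm (hham w)
    exact ⟨c 1, hc0 ▸ hadj 0 (by omega)⟩
  obtain ⟨u, hu⟩ := hnb
  have hdeg : 3 ≤ G.degree v := by
    obtain ⟨m, c, h3, hcard, hc0, hcm, hadj, hinj, hne, -⟩ := exists_enum G u v hu.ne (hham u)
    have a1 : G.Adj v (c 1) := hc0 ▸ hadj 0 (by omega)
    have a2 : G.Adj v (c (m - 1)) := by
      have := hadj (m - 1) (by omega)
      rw [Nat.sub_add_cancel (by omega), hcm] at this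
      exact this.symm
    have n12 : c 1 ≠ c (m - 1) := by
      intro h
      have := hinj _ _ (by omega) (by omega) h
      omega
    rw [← card_neighborFinset_eq_degree,
      ← card_eq_three.mpr ⟨u, c 1, c (m - 1), (hne _).symm, (hne _).symm, n12, rfl⟩]
    apply card_le_card
    intro x hx
    simp only [mem_insert, mem_singleton] at hx
    rw [mem_neighborFinset]
    rcases hx with rfl | rfl | rfl <;> assumption
  refine ⟨hdeg, ?_⟩
  obtain ⟨m, c, h3, hcard, hc0, hcm, hadj, hinj, hne, hsurj⟩ := exists_enum G v w hw (hham v)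
  have hcm0 : c m = c 0 := by rw [hcm, hc0]
  set J := (range m).filter (fun i => G.Adj v (c i)) with hJ
  have hJm : ∀ i, i ∈ J ↔ i < m ∧ G.Adj v (c i) := by intro i; simp [hJ]
  have h1 : J.image c = G.neighborFinset v := by
    ext x
    rw [mem_neighborFinset, mem_image]
    constructor
    · rintro ⟨i, h, rfl⟩
      exact ((hJm i).1 h).2
    · intro hx
      obtain ⟨i, hi, rfl⟩ := hsurj x hx.ne'
      exact ⟨i, (hJm i).2 ⟨hi, hx⟩, rfl⟩
  have hcJ : G.degree v = #J := by
    rw [← card_neighborFinset_eq_degree, ← h1]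
    refine card_image_of_injOn ?_
    intro i hi j hj hij
    exact hinj i j ((hJm i).1 hi).1 ((hJm j).1 hj).1 hij
  have hsucc : #(J.image (fun i => c (i + 1))) = #J := by
    refine card_image_of_injOn ?_
    intro i hi j hj hij
    have hi := ((hJm i).1 hi).1
    have hj := ((hJm j).1 hj).1
    simp only at hij
    rcases Nat.lt_or_eq_of_le (Nat.succ_le_of_lt hi) with h1 | h1 <;>
    rcases Nat.lt_or_eq_of_le (Nat.succ_le_of_lt hj) with h2 | h2
    · have := hinj _ _ h1 h2 hij
      omega
    · have := hinj (i + 1) 0 h1 (by omega) (by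
        rw [hij, hc0, ← hcm]; congr 1)
      omega
    · have := hinj (j + 1) 0 h2 (by omega) (by
        rw [← hij, hc0, ← hcm]; congr 1)
      omega
    · omega
  have hvJ : v ∉ J.image (fun i => c (i + 1)) := by
    simp only [mem_image, not_exists, not_and]
    exact fun i _ => hne _
  have hnv : ∀ i ∈ J, ¬ G.Adj v (c (i + 1)) := fun i hi =>
    not_adj_succ G hnot v m c h3 hcard hcm0 hadj hinj hne i ((hJm i).1 hi).1 ((hJm i).1 hi).2
  have hnn : ∀ i ∈ J, ∀ j ∈ J, ¬ G.Adj (c (i + 1)) (c (j + 1)) := by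
    intro i hi j hj
    have hi' := (hJm i).1 hi
    have hj' := (hJm j).1 hj
    rcases lt_trichotomy i j with h | rfl | h
    · exact not_adj_succ_succ G hnot v m c h3 hcard hcm0 hadj hinj hne i j h hj'.1 hi'.2 hj'.2
    · exact G.irrefl
    · intro hh
      exact not_adj_succ_succ G hnot v m c h3 hcard hcm0 hadj hinj hne j i h hi'.1 hj'.2 hi'.2
        hh.symm
  have := two_mul_card_indep G u v hu.ne (hham u) (insert v (J.image (fun i => c (i + 1)))) ?_ ?_
  · rw [card_insert_of_notMem hvJ] at this
    omega
  · simp only [mem_insert, mem_image, not_or, not_exists, not_and]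
    refine ⟨hu.ne', ?_⟩
    rintro i hi rfl
    exact hnv i hi hu
  · intro x hx y hy
    simp only [mem_insert, mem_image] at hx hy
    rcases hx with rfl | ⟨i, hi, rfl⟩ <;> rcases hy with rfl | ⟨j, hj, rfl⟩
    · exact G.irrefl
    · exact hnv j hj
    · exact fun h => hnv i hi h.symm
    · exact hnn i hi j hj

theorem hypohamiltonian_card_ge_ten {α : Type*} [Fintype α] [DecidableEq α]
    (G : SimpleGraph α) (hG : Hypohamiltonian G) :
    10 ≤ Fintype.card α := by
  classical
  by_contra hlt
  have hb := degree_bound G hG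
  obtain ⟨v⟩ := hG.1
  have hn : Fintype.card α = 9 := by
    have := hb v
    omega
  have hreg : ∀ v, G.degree v = 3 := by
    intro v
    have := hb v
    omega
  have hsum := G.sum_degrees_eq_twice_card_edges
  simp only [hreg, sum_const, card_univ, hn, smul_eq_mul] at hsum
  omega
end
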